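/- arXiv:1009.0516 — 4 statements merged into one kernel-verified Lean document; each statement's English description precedes it below -/
import Mathlib

section
/- For all real α > 2, c > 0 and r > 0, the improper integral ∫ᵣ^∞ (1 − exp(−c·v^{−α})) · v dv converges and equals −(r²/2)·(1 − exp(−c·r^{−α})) + (c^{2/α}/2) · ∫₀^{c·r^{−α}} t^{−2/α} · exp(−t) dt. -/
open Real MeasureTheory intervalIntegral

theorem stmt1 (α c r : ℝ) (hα : 2 < α) (hc : 0 < c) (hr : 0 < r) :
    IntegrableOn (fun v : ℝ => (1 - Real.exp (-c * v ^ (-α))) * v) (Set.Ioi r) ∧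
    ∫ v in Set.Ioi r, (1 - Real.exp (-c * v ^ (-α))) * v
      = -(r ^ 2 / 2) * (1 - Real.exp (-c * r ^ (-α)))
        + (c ^ (2 / α) / 2) * ∫ t in (0 : ℝ)..(c * r ^ (-α)), t ^ (-(2 / α)) * Real.exp (-t) := by
  have hα0 : 0 < α := by linarith
  have hlt : 2 / α < 1 := by rw [div_lt_one hα0]; exact hα
  have hint : ∀ a b : ℝ, IntervalIntegrable (fun t : ℝ => t ^ (-(2 / α)) * Real.exp (-t)) volume a b := by
    intro a b
    exact (intervalIntegrable_rpow' (by linarith)).mul_continuousOn (by fun_prop)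
  set γ : ℝ → ℝ := fun x => ∫ t in (0 : ℝ)..x, t ^ (-(2 / α)) * Real.exp (-t) with hγ
  have hγc : Continuous γ := intervalIntegral.continuous_primitive hint 0
  have hγd : ∀ x : ℝ, 0 < x → HasDerivAt γ (x ^ (-(2 / α)) * Real.exp (-x)) x := by
    intro x hx
    apply intervalIntegral.integral_hasDerivAt_right (hint 0 x)
    · apply Measurable.stronglyMeasurable (by fun_prop) |>.stronglyMeasurableAtFilter
    · exact (Real.continuousAt_rpow_const x _ (Or.inl hx.ne')).mul (by fun_prop)
  let G : ℝ → ℝ := fun v => v ^ 2 / 2 * (1 - Real.exp (-c * v ^ (-α))) - c ^ (2 / α) / 2 * γ (c * v ^ (-α))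
  have hd : ∀ v ∈ Set.Ici r, HasDerivAt G ((1 - Real.exp (-c * v ^ (-α))) * v) v := by
    intro v hv
    have hv0 : 0 < v := lt_of_lt_of_le hr hv
    have hp : HasDerivAt (fun v : ℝ => v ^ (-α)) (-α * v ^ (-α - 1)) v :=
      Real.hasDerivAt_rpow_const (Or.inl hv0.ne')
    have h1 := ((hp.const_mul (-c)).exp).const_sub 1
    have h2 := ((hasDerivAt_pow 2 v).div_const 2).mul h1
    have h3 := ((hγd (c * v ^ (-α)) (by positivity)).comp v (hp.const_mul c)).const_mul (c ^ (2 / α) / 2)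
    refine (h2.sub h3).congr_deriv ?_
    have e : c ^ (2 / α) * (c * v ^ (-α)) ^ (-(2 / α)) = v ^ 2 := by
      rw [Real.mul_rpow hc.le (by positivity), ← mul_assoc, ← Real.rpow_add hc, ← Real.rpow_mul hv0.le]
      have : -α * -(2 / α) = (2 : ℕ) := by field_simp; norm_num
      rw [this, Real.rpow_natCast]; simp
    rw [show -(c * v ^ (-α)) = -c * v ^ (-α) by ring]
    simp only [Nat.cast_ofNat]
    linear_combination (Real.exp (-c * v ^ (-α)) * (c * (α * v ^ (-α - 1))) / 2) * e
  have hpos : ∀ v ∈ Set.Ioi r, 0 ≤ (1 - Real.exp (-c * v ^ (-α))) * v := by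
    intro v hv
    have hv0 : 0 < v := lt_trans hr hv
    have : 0 ≤ c * v ^ (-α) := by positivity
    have : Real.exp (-c * v ^ (-α)) ≤ 1 := Real.exp_le_one_iff.2 (by linarith)
    exact mul_nonneg (by linarith) hv0.le
  have ht : Filter.Tendsto G Filter.atTop (nhds 0) := by
    have t1 : Filter.Tendsto (fun v : ℝ => v ^ 2 / 2 * (1 - Real.exp (-c * v ^ (-α)))) Filter.atTop (nhds 0) := by
      have t0 : Filter.Tendsto (fun v : ℝ => c / 2 * v ^ (-(α - 2))) Filter.atTop (nhds 0) := by
        simpa using (tendsto_rpow_neg_atTop (show 0 < α - 2 by linarith)).const_mul (c / 2)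
      refine squeeze_zero' ?_ ?_ t0
      · filter_upwards [Filter.eventually_gt_atTop r] with v hv
        have hv0 : 0 < v := lt_trans hr hv
        have := mul_nonneg (hpos v hv) hv0.le
        nlinarith
      · filter_upwards [Filter.eventually_gt_atTop r] with v hv
        have hv0 : 0 < v := lt_trans hr hv
        have h := Real.add_one_le_exp (-c * v ^ (-α))
        have e : v ^ (-(α - 2)) = v ^ 2 * v ^ (-α) := by
          rw [← Real.rpow_natCast, ← Real.rpow_add hv0]; congr 1; push_cast; ring
        rw [e]
        have := mul_le_mul_of_nonneg_left (show 1 - Real.exp (-c * v ^ (-α)) ≤ c * v ^ (-α) by linarith)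
          (show 0 ≤ v ^ 2 / 2 by positivity)
        linarith
    have t2 : Filter.Tendsto (fun v : ℝ => γ (c * v ^ (-α))) Filter.atTop (nhds 0) := by
      have h0 : γ 0 = 0 := by simp [hγ]
      have := (hγc.tendsto (c * 0)).comp ((tendsto_rpow_neg_atTop hα0).const_mul c)
      rw [mul_zero, h0] at this
      exact this
    simpa [G] using t1.sub (t2.const_mul (c ^ (2 / α) / 2))
  refine ⟨integrableOn_Ioi_deriv_of_nonneg' hd hpos ht, ?_⟩
  rw [integral_Ioi_of_hasDerivAt_of_nonneg' hd hpos ht]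
  simp only [G]
  ring
end

section
/- Let α > 2, β > 0 and λ > 0 be real, and for ε ≥ 0 define F(ε) = πλ ∫₀^∞ exp(−πλβv − ε·v^{α/2}) dv. Then F(0) = 1/β, and as ε → 0⁺, (F(ε) − 1/β)/ε tends to −Γ(1 + α/2) · (πλβ)^{−α/2} / β, where Γ is the Gamma function; equivalently F(ε) = 1/β − ε·Γ(1+α/2)·(πλβ)^{−α/2}/β + o(ε). -/
open Real MeasureTheory Filter

theorem stmt5 (α β lam : ℝ) (hα : 2 < α) (hβ : 0 < β) (hlam : 0 < lam)
    (F : ℝ → ℝ)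
    (hF : ∀ ε : ℝ, 0 ≤ ε →
      F ε = π * lam * ∫ v in Set.Ioi (0 : ℝ), Real.exp (-(π * lam * β * v) - ε * v ^ (α / 2))) :
    F 0 = 1 / β ∧
    Tendsto (fun ε : ℝ => (F ε - 1 / β) / ε) (nhdsWithin 0 (Set.Ioi 0))
      (nhds (-(Real.Gamma (1 + α / 2) * (π * lam * β) ^ (-(α / 2)) / β))) := by
  have hpi := Real.pi_pos
  have hc : 0 < π * lam * β := by positivity
  have hcβ : π * lam = (π * lam * β) / β := by field_simp
  set c := π * lam * β with hcdef
  set s := α / 2 with hs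
  have hs0 : 0 < s := by rw [hs]; linarith
  have hm : ∀ ε : ℝ, Measurable (fun v : ℝ => Real.exp (-(c * v) - ε * v ^ s)) := by
    intro ε; fun_prop
  have hI0 : IntegrableOn (fun v : ℝ => Real.exp (-(c * v))) (Set.Ioi 0) := by
    have := integrableOn_rpow_mul_exp_neg_mul_rpow (p := 1) (s := 0) (b := c)
      (by norm_num) one_pos hc
    simpa using this
  have hI1 : IntegrableOn (fun v : ℝ => v ^ s * Real.exp (-(c * v))) (Set.Ioi 0) := by
    have := integrableOn_rpow_mul_exp_neg_mul_rpow (p := 1) (s := s) (b := c)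
      (by linarith) one_pos hc
    simpa using this
  have hIε : ∀ ε : ℝ, 0 ≤ ε →
      IntegrableOn (fun v : ℝ => Real.exp (-(c * v) - ε * v ^ s)) (Set.Ioi 0) := by
    intro ε hε
    refine Integrable.mono' hI0 (hm ε).aestronglyMeasurable ?_
    refine (ae_restrict_iff' measurableSet_Ioi).mpr <| ae_of_all _ fun v (hv : 0 < v) ↦ ?_
    rw [Real.norm_eq_abs, Real.abs_exp]
    apply Real.exp_le_exp.mpr
    have : 0 ≤ ε * v ^ s := by positivity
    linarith
  have h0 : ∫ v in Set.Ioi (0 : ℝ), Real.exp (-(c * v)) = 1 / c := by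
    have := Real.integral_rpow_mul_exp_neg_mul_Ioi (a := 1) one_pos hc
    simpa using this
  have h1 : ∫ v in Set.Ioi (0 : ℝ), v ^ s * Real.exp (-(c * v))
      = (1 / c) ^ (1 + s) * Real.Gamma (1 + s) := by
    have := Real.integral_rpow_mul_exp_neg_mul_Ioi (a := 1 + s) (by linarith) hc
    simpa using this
  have hF0 : F 0 = 1 / β := by
    rw [hF 0 le_rfl]
    simp only [zero_mul, sub_zero]
    rw [h0, hcβ]; field_simp
  refine ⟨hF0, ?_⟩
  have key : Tendsto (fun ε : ℝ => ∫ v in Set.Ioi (0 : ℝ),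
      (Real.exp (-(c * v) - ε * v ^ s) - Real.exp (-(c * v))) / ε) (nhdsWithin 0 (Set.Ioi 0))
      (nhds (∫ v in Set.Ioi (0 : ℝ), -(v ^ s * Real.exp (-(c * v))))) := by
    refine tendsto_integral_filter_of_dominated_convergence
      (fun v => v ^ s * Real.exp (-(c * v))) ?_ ?_ hI1 ?_
    · refine Eventually.of_forall fun ε => ?_
      exact Measurable.aestronglyMeasurable (by fun_prop)
    · filter_upwards [self_mem_nhdsWithin] with ε hε
      have hε : 0 < ε := hε
      refine (ae_restrict_iff' measurableSet_Ioi).mpr <| ae_of_all _ fun v (hv : 0 < v) ↦ ?_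
      have hx : 0 ≤ ε * v ^ s := by positivity
      have e1 : Real.exp (-(ε * v ^ s)) ≤ 1 := Real.exp_le_one_iff.mpr (by linarith)
      have e2 := Real.add_one_le_exp (-(ε * v ^ s))
      have e3 := Real.exp_pos (-(c * v))
      rw [sub_eq_add_neg (-(c * v)), Real.exp_add, Real.norm_eq_abs, abs_div, abs_of_pos hε,
        div_le_iff₀ hε, abs_le]
      constructor <;> nlinarith
    · refine (ae_restrict_iff' measurableSet_Ioi).mpr <| ae_of_all _ fun v (hv : 0 < v) ↦ ?_
      have hd : HasDerivAt (fun ε : ℝ => Real.exp (-(c * v) - ε * v ^ s))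
          (-(v ^ s * Real.exp (-(c * v)))) 0 := by
        have := (((hasDerivAt_id (0 : ℝ)).mul_const (v ^ s)).const_sub (-(c * v))).exp
        convert! this using 1
        simp; ring
      have := hd.hasDerivWithinAt (s := Set.Ioi 0)
      rw [hasDerivWithinAt_iff_tendsto_slope' (by simp)] at this
      refine this.congr fun ε => ?_
      simp [slope_def_field]
  have key2 := key.const_mul (π * lam)
  have hval : π * lam * ∫ v in Set.Ioi (0 : ℝ), -(v ^ s * Real.exp (-(c * v)))
      = -(Real.Gamma (1 + s) * c ^ (-s) / β) := by
    rw [integral_neg, h1, hcβ, one_div, Real.inv_rpow hc.le, Real.rpow_add hc, Real.rpow_one,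
      Real.rpow_neg hc.le]
    have := Real.rpow_pos_of_pos hc s
    field_simp
  rw [hval] at key2
  refine key2.congr' ?_
  filter_upwards [self_mem_nhdsWithin] with ε hε
  have hε : 0 < ε := hε
  rw [integral_div, integral_sub (hIε ε hε.le) hI0, h0, hF ε hε.le]
  have : π * lam * (1 / c) = 1 / β := by rw [hcβ]; field_simp
  rw [← this]; ring
end

section
/- Define f(t) = √(e^t − 1) · (π/2 − arctan(1/√(e^t − 1))) for t > 0. Then the improper integral τ = ∫₀^∞ (1 + f(t))^{−1} dt converges, and 1.4 < τ < 1.6. -/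
open Real MeasureTheory

noncomputable def fRate (t : ℝ) : ℝ :=
  Real.sqrt (Real.exp t - 1) * (π / 2 - Real.arctan (1 / Real.sqrt (Real.exp t - 1)))

lemma aux_tan {h : ℝ} (h0 : 0 ≤ h) (h1 : h < π / 2) : h * Real.cos h ≤ Real.sin h := by
  have hc : 0 < Real.cos h := Real.cos_pos_of_mem_Ioo ⟨by linarith, h1⟩
  have := Real.le_tan h0 h1
  rw [Real.tan_eq_sin_div_cos, le_div_iff₀ hc] at this
  exact this

lemma aux_up {θ : ℝ} (h0 : 0 ≤ θ) (h1 : θ < π / 2) : θ * (1 + Real.cos θ) ≤ 2 * Real.sin θ := by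
  have h := aux_tan (h := θ / 2) (by linarith) (by linarith)
  have hc : 0 < Real.cos (θ / 2) := Real.cos_pos_of_mem_Ioo ⟨by linarith, by linarith⟩
  have e1 : Real.cos θ = 2 * Real.cos (θ / 2) ^ 2 - 1 := by
    rw [← Real.cos_two_mul]; congr 1; ring
  have e2 : Real.sin θ = 2 * Real.sin (θ / 2) * Real.cos (θ / 2) := by
    rw [← Real.sin_two_mul]; congr 1; ring
  rw [e1, e2]
  nlinarith [mul_le_mul_of_nonneg_right h hc.le]

lemma aux_low {θ : ℝ} (h0 : 0 ≤ θ) (h1 : θ < π / 2) : 3 * Real.sin θ ≤ θ * (2 + Real.cos θ) := by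
  have hd : ∀ x : ℝ, HasDerivAt (fun x => x * (2 + Real.cos x) - 3 * Real.sin x)
      (1 * (2 + Real.cos x) + x * (-Real.sin x) - 3 * Real.cos x) x := by
    intro x
    exact ((hasDerivAt_id x).mul ((Real.hasDerivAt_cos x).const_add 2)).sub
      ((Real.hasDerivAt_sin x).const_mul 3)
  have hm : MonotoneOn (fun x => x * (2 + Real.cos x) - 3 * Real.sin x) (Set.Icc 0 (π / 2)) := by
    apply monotoneOn_of_deriv_nonneg (convex_Icc _ _)
    · fun_prop
    · fun_prop
    · intro x hx
      rw [interior_Icc] at hx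
      rw [(hd x).deriv]
      obtain ⟨a, b⟩ := hx
      have h := aux_tan (h := x / 2) (by linarith) (by linarith)
      have hs : 0 ≤ Real.sin (x / 2) := Real.sin_nonneg_of_nonneg_of_le_pi (by linarith) (by linarith)
      have e1 : Real.cos x = 1 - 2 * Real.sin (x / 2) ^ 2 := by
        have := Real.cos_two_mul (x / 2)
        have h2 := Real.sin_sq_add_cos_sq (x / 2)
        rw [show 2 * (x / 2) = x by ring] at this
        linarith
      have e2 : Real.sin x = 2 * Real.sin (x / 2) * Real.cos (x / 2) := by
        rw [← Real.sin_two_mul]; congr 1; ring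
      rw [e1, e2]
      nlinarith [mul_le_mul_of_nonneg_right h hs]
  have := hm (Set.left_mem_Icc.2 (by linarith)) ⟨h0, h1.le⟩ h0
  simp at this
  linarith

lemma fRate_bounds {t : ℝ} (ht : 0 < t) :
    3 * (Real.exp (t / 2) ^ 2 - 1) ≤ fRate t * (2 * Real.exp (t / 2) + 1) ∧
    fRate t ≤ 2 * (Real.exp (t / 2) - 1) ∧ fRate t ≤ 8 / 5 * Real.exp (t / 2) := by
  have hr : 1 < Real.exp (t / 2) := Real.one_lt_exp_iff.2 (by linarith)
  have hr2 : Real.exp t = Real.exp (t / 2) ^ 2 := by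
    rw [← Real.exp_nat_mul]; congr 1; push_cast; ring
  unfold fRate
  rw [hr2]
  set r := Real.exp (t / 2) with hrdef
  have hpos : 0 < r ^ 2 - 1 := by nlinarith
  have hs : 0 < √(r ^ 2 - 1) := Real.sqrt_pos.2 hpos
  have hss : √(r ^ 2 - 1) ^ 2 = r ^ 2 - 1 := Real.sq_sqrt hpos.le
  set s := √(r ^ 2 - 1) with hsdef
  have e : π / 2 - Real.arctan (1 / s) = Real.arctan s := by
    rw [one_div, Real.arctan_inv_of_pos hs]; ring
  rw [e]
  have hr' : √(1 + s ^ 2) = r := by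
    rw [hss]; rw [show 1 + (r ^ 2 - 1) = r ^ 2 by ring]; exact Real.sqrt_sq (by linarith)
  have hc : Real.cos (Real.arctan s) = 1 / r := by rw [Real.cos_arctan, hr']
  have hsn : Real.sin (Real.arctan s) = s / r := by rw [Real.sin_arctan, hr']
  have h0 : 0 ≤ Real.arctan s := Real.arctan_nonneg.2 hs.le
  have h1 := Real.arctan_lt_pi_div_two s
  have hu := aux_up h0 h1
  have hl := aux_low h0 h1
  rw [hc, hsn] at hu hl
  set θ := Real.arctan s
  have hr0 : 0 < r := by linarith
  have hu' : θ * (r + 1) ≤ 2 * s := by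
    have := mul_le_mul_of_nonneg_right hu hr0.le
    field_simp at this
    linarith
  have hl' : 3 * s ≤ θ * (2 * r + 1) := by
    have := mul_le_mul_of_nonneg_right hl hr0.le
    field_simp at this
    linarith
  have hsr : s ≤ r := by nlinarith
  refine ⟨by nlinarith, ?_, ?_⟩
  · have : s * θ * (r + 1) ≤ 2 * (r - 1) * (r + 1) := by nlinarith
    exact le_of_mul_le_mul_right this (by linarith)
  · have hp : θ ≤ 8 / 5 := by linarith [Real.pi_lt_d2]
    nlinarith

lemma int_h {p q a : ℝ} (hp : 0 < p) (hq : q ≠ 0) (ha : 0 < p - q * Real.exp (-a / 2)) :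
    IntegrableOn (fun t => (p * Real.exp (t / 2) - q)⁻¹) (Set.Ioi a) ∧
    ∫ t in Set.Ioi a, (p * Real.exp (t / 2) - q)⁻¹ =
      2 / q * Real.log p - 2 / q * Real.log (p - q * Real.exp (-a / 2)) := by
  have hpos : ∀ x ∈ Set.Ici a, 0 < p - q * Real.exp (-x / 2) := by
    intro x hx
    have hx' : a ≤ x := hx
    have h1 : Real.exp (-x / 2) ≤ Real.exp (-a / 2) := Real.exp_le_exp.2 (by linarith)
    have h2 := Real.exp_pos (-x / 2)
    rcases lt_or_gt_of_ne hq with h | h <;> nlinarith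
  have key : ∀ x, p * Real.exp (x / 2) - q = Real.exp (x / 2) * (p - q * Real.exp (-x / 2)) := by
    intro x
    have : Real.exp (x / 2) * Real.exp (-x / 2) = 1 := by
      rw [← Real.exp_add]; simp [neg_div]
    linear_combination (-q) * (-this)
  have hd : ∀ x ∈ Set.Ici a, HasDerivAt (fun t => 2 / q * Real.log (p - q * Real.exp (-t / 2)))
      ((p * Real.exp (x / 2) - q)⁻¹) x := by
    intro x hx
    have h1 : HasDerivAt (fun t : ℝ => -t / 2) (-1 / 2) x := (hasDerivAt_id x).neg.div_const 2
    have h2 := ((((h1.exp).const_mul q).const_sub p).log (hpos x hx).ne').const_mul (2 / q)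
    refine h2.congr_deriv ?_
    rw [key]
    have h3 : Real.exp (-x / 2) = (Real.exp (x / 2))⁻¹ := by
      rw [← Real.exp_neg, neg_div]
    have h4 := (hpos x hx).ne'
    have h5 := (Real.exp_pos (x / 2)).ne'
    rw [mul_inv, ← h3]
    field_simp
  have hn : ∀ x ∈ Set.Ioi a, 0 ≤ (p * Real.exp (x / 2) - q)⁻¹ := by
    intro x hx
    rw [key]
    have := hpos x (Set.Ioi_subset_Ici_self hx)
    positivity
  have hlim : Filter.Tendsto (fun t => 2 / q * Real.log (p - q * Real.exp (-t / 2))) Filter.atTop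
      (nhds (2 / q * Real.log p)) := by
    have h1 : Filter.Tendsto (fun t : ℝ => Real.exp (-t / 2)) Filter.atTop (nhds 0) := by
      apply Real.tendsto_exp_atBot.comp
      have : (fun t : ℝ => -t / 2) = fun t => -(t / 2) := by ext; ring
      rw [this]
      exact Filter.tendsto_neg_atTop_atBot.comp (Filter.tendsto_id.atTop_div_const (by norm_num))
    have h2 : Filter.Tendsto (fun t : ℝ => p - q * Real.exp (-t / 2)) Filter.atTop (nhds p) := by
      simpa using (h1.const_mul q).const_sub p
    exact (h2.log hp.ne').const_mul _
  exact ⟨integrableOn_Ioi_deriv_of_nonneg' hd hn hlim,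
    integral_Ioi_of_hasDerivAt_of_nonneg' hd hn hlim⟩

lemma exp_half_log (c : ℝ) (hc : 0 < c) : Real.exp (-(2 * Real.log c) / 2) = c⁻¹ := by
  rw [show -(2 * Real.log c) / 2 = -Real.log c by ring, Real.exp_neg, Real.exp_log hc]

lemma split_int {F : ℝ → ℝ} {T : ℝ} (hT : 0 ≤ T) (hF : IntegrableOn F (Set.Ioi 0)) :
    ∫ t in Set.Ioi (0:ℝ), F t = (∫ t in Set.Ioc 0 T, F t) + ∫ t in Set.Ioi T, F t := by
  rw [← Set.Ioc_union_Ioi_eq_Ioi hT]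
  exact setIntegral_union (Set.Ioc_disjoint_Ioi le_rfl) measurableSet_Ioi
    (hF.mono_set Set.Ioc_subset_Ioi_self) (hF.mono_set (Set.Ioi_subset_Ioi hT))

lemma fRate_low {t : ℝ} (ht : 0 < t) : 3 / 2 * Real.exp (t / 2) - 1 / 2 ≤ 1 + fRate t := by
  obtain ⟨h, -, -⟩ := fRate_bounds ht
  have hr : 1 < Real.exp (t / 2) := Real.one_lt_exp_iff.2 (by linarith)
  set r := Real.exp (t / 2)
  have : (3 / 2 * r - 1 / 2 - 1) * (2 * r + 1) ≤ fRate t * (2 * r + 1) := by nlinarith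
  have := le_of_mul_le_mul_right this (by linarith)
  linarith

lemma fRate_int : IntegrableOn (fun t : ℝ => (1 + fRate t)⁻¹) (Set.Ioi 0) := by
  have h := (int_h (p := 3 / 2) (q := 1 / 2) (a := 0) (by norm_num) (by norm_num) (by norm_num)).1
  refine Integrable.mono' h ?_ ?_
  · apply Measurable.aestronglyMeasurable
    unfold fRate
    fun_prop
  · refine (ae_restrict_iff' measurableSet_Ioi).2 (Filter.Eventually.of_forall fun t ht => ?_)
    have ht : 0 < t := ht
    have h1 := fRate_low ht
    have hr : 1 < Real.exp (t / 2) := Real.one_lt_exp_iff.2 (by linarith)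
    rw [Real.norm_of_nonneg (inv_nonneg.2 (by linarith))]
    exact inv_anti₀ (by linarith) h1

theorem stmt12 :
    IntegrableOn (fun t : ℝ => (1 + fRate t)⁻¹) (Set.Ioi 0) ∧
    1.4 < ∫ t in Set.Ioi (0 : ℝ), (1 + fRate t)⁻¹ ∧
    (∫ t in Set.Ioi (0 : ℝ), (1 + fRate t)⁻¹) < 1.6 := by
  have hI := fRate_int
  refine ⟨hI, ?_, ?_⟩
  · have hT : 0 ≤ 2 * Real.log 4 := by have := Real.log_nonneg (x := 4) (by norm_num); linarith
    have e4 := exp_half_log 4 (by norm_num)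
    obtain ⟨i1, v1⟩ := int_h (p := 2) (q := 1) (a := 0) (by norm_num) (by norm_num) (by norm_num)
    obtain ⟨i2, v2⟩ := int_h (p := 2) (q := 1) (a := 2 * Real.log 4) (by norm_num) (by norm_num)
      (by rw [e4]; norm_num)
    obtain ⟨i3, v3⟩ := int_h (p := 8 / 5) (q := -1) (a := 2 * Real.log 4) (by norm_num)
      (by norm_num) (by rw [e4]; norm_num)
    have s1 := split_int hT i1
    rw [split_int hT hI]
    have b1 : ∫ t in Set.Ioc 0 (2 * Real.log 4), (2 * Real.exp (t / 2) - 1)⁻¹ ≤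
        ∫ t in Set.Ioc 0 (2 * Real.log 4), (1 + fRate t)⁻¹ := by
      apply setIntegral_mono_on (i1.mono_set Set.Ioc_subset_Ioi_self)
        (hI.mono_set Set.Ioc_subset_Ioi_self) measurableSet_Ioc
      intro t ht
      have h1 := fRate_low ht.1
      have hr : 1 < Real.exp (t / 2) := Real.one_lt_exp_iff.2 (by linarith [ht.1])
      exact inv_anti₀ (by linarith) (by linarith [(fRate_bounds ht.1).2.1])
    have b2 : ∫ t in Set.Ioi (2 * Real.log 4), (8 / 5 * Real.exp (t / 2) - -1)⁻¹ ≤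
        ∫ t in Set.Ioi (2 * Real.log 4), (1 + fRate t)⁻¹ := by
      apply setIntegral_mono_on i3 (hI.mono_set (Set.Ioi_subset_Ioi hT)) measurableSet_Ioi
      intro t ht
      have ht0 : 0 < t := lt_of_le_of_lt hT ht
      have h1 := fRate_low ht0
      have hr : 1 < Real.exp (t / 2) := Real.one_lt_exp_iff.2 (by linarith)
      exact inv_anti₀ (by linarith) (by linarith [(fRate_bounds ht0).2.2])
    rw [e4] at v2 v3
    rw [v2] at s1
    rw [v1] at s1
    rw [v3] at b2
    norm_num at s1 b2
    have l1 : Real.log (7 / 4) + Real.log (37 / 20) - Real.log (8 / 5) = Real.log 2 + Real.log (259 / 256) := by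
      rw [← Real.log_mul (by norm_num) (by norm_num), ← Real.log_div (by norm_num) (by norm_num),
        ← Real.log_mul (by norm_num) (by norm_num)]
      norm_num
    have l2 := Real.one_sub_inv_le_log_of_pos (x := 259 / 256) (by norm_num)
    have l3 := Real.log_two_gt_d9
    norm_num at l2 l3 ⊢
    linarith
  · have hT : 0 ≤ 2 * Real.log 2 := by have := Real.log_nonneg (x := 2) (by norm_num); linarith
    have e4 := exp_half_log 2 (by norm_num)
    obtain ⟨i1, v1⟩ := int_h (p := 9 / 5) (q := 4 / 5) (a := 0) (by norm_num) (by norm_num)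
      (by norm_num)
    obtain ⟨i2, v2⟩ := int_h (p := 9 / 5) (q := 4 / 5) (a := 2 * Real.log 2) (by norm_num)
      (by norm_num) (by rw [e4]; norm_num)
    obtain ⟨i3, v3⟩ := int_h (p := 3 / 2) (q := 1 / 5) (a := 2 * Real.log 2) (by norm_num)
      (by norm_num) (by rw [e4]; norm_num)
    have s1 := split_int hT i1
    rw [split_int hT hI]
    have b1 : ∫ t in Set.Ioc 0 (2 * Real.log 2), (1 + fRate t)⁻¹ ≤
        ∫ t in Set.Ioc 0 (2 * Real.log 2), (9 / 5 * Real.exp (t / 2) - 4 / 5)⁻¹ := by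
      apply setIntegral_mono_on (hI.mono_set Set.Ioc_subset_Ioi_self)
        (i1.mono_set Set.Ioc_subset_Ioi_self) measurableSet_Ioc
      intro t ht
      have hr : 1 < Real.exp (t / 2) := Real.one_lt_exp_iff.2 (by linarith [ht.1])
      have hr2 : Real.exp (t / 2) ≤ 2 := by
        rw [← Real.le_log_iff_exp_le (by norm_num)]; linarith [ht.2]
      have h := (fRate_bounds ht.1).1
      refine inv_anti₀ (by linarith) ?_
      set r := Real.exp (t / 2)
      have : (9 / 5 * r - 4 / 5 - 1) * (2 * r + 1) ≤ fRate t * (2 * r + 1) := by nlinarith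
      have := le_of_mul_le_mul_right this (by linarith)
      linarith
    have b2 : ∫ t in Set.Ioi (2 * Real.log 2), (1 + fRate t)⁻¹ ≤
        ∫ t in Set.Ioi (2 * Real.log 2), (3 / 2 * Real.exp (t / 2) - 1 / 5)⁻¹ := by
      apply setIntegral_mono_on (hI.mono_set (Set.Ioi_subset_Ioi hT)) i3 measurableSet_Ioi
      intro t ht
      have ht0 : 0 < t := lt_of_le_of_lt hT ht
      have hr2 : 2 ≤ Real.exp (t / 2) := by
        rw [← Real.log_le_iff_le_exp (by norm_num)]
        have : 2 * Real.log 2 < t := ht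
        linarith
      have h := (fRate_bounds ht0).1
      refine inv_anti₀ (by linarith) ?_
      set r := Real.exp (t / 2)
      have : (3 / 2 * r - 1 / 5 - 1) * (2 * r + 1) ≤ fRate t * (2 * r + 1) := by nlinarith
      have := le_of_mul_le_mul_right this (by linarith)
      linarith
    rw [e4] at v2 v3
    rw [v2] at s1
    rw [v1] at s1
    rw [v3] at b2
    norm_num at s1 b2
    have l1 : Real.log (3 / 2) - Real.log (7 / 5) = Real.log (15 / 14) := by
      rw [← Real.log_div (by norm_num) (by norm_num)]
      norm_num
    have l2 := Real.log_le_sub_one_of_pos (x := 15 / 14) (by norm_num)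
    have l3 : Real.log (7 / 5) ≤ 0.352 := by
      rw [Real.log_le_iff_le_exp (by norm_num)]
      have := Real.quadratic_le_exp_of_nonneg (x := 0.352) (by norm_num)
      norm_num at this ⊢
      linarith
    norm_num at l2 l3 ⊢
    linarith
end

section
/- Let α > 2, λ > 0, μ > 0 and σ² ≥ 0 be real. Define f(t) = (e^t − 1)^{2/α} · ∫_{(e^t−1)^{−2/α}}^∞ (1 + x^{α/2})^{−1} dx for t > 0, and for δ > 0 define τ(δ) = (1/δ) ∫₀^∞ ∫₀^∞ exp(−πλr²) · exp(−σ²μ r^α (e^t − 1)) · exp(−(πλr²/δ) f(t)) dt · 2πλ r dr. Then for all 0 < δ₁ ≤ δ₂, τ(δ₂) ≤ τ(δ₁); i.e. the average rate under frequency reuse is maximized at δ = 1. -/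
open Real MeasureTheory

lemma aux_int (α a : ℝ) (hα : 2 < α) (ha : 0 < a) :
    IntegrableOn (fun x : ℝ => (1 + x ^ (α / 2))⁻¹) (Set.Ioi a) := by
  have h := integrableOn_Ioi_rpow_of_lt (a := -(α/2)) (by linarith) ha
  refine Integrable.mono' h ?_ ?_
  · exact (Measurable.aestronglyMeasurable (by fun_prop))
  · refine (ae_restrict_iff' measurableSet_Ioi).2 (Filter.Eventually.of_forall fun x hx => ?_)
    have hx0 : 0 < x := lt_trans ha hx
    have hp : 0 < x ^ (α/2) := Real.rpow_pos_of_pos hx0 _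
    rw [Real.rpow_neg hx0.le, Real.norm_of_nonneg (by positivity)]
    exact inv_anti₀ hp (by linarith)

lemma aux_cpos (α : ℝ) (hα : 2 < α) :
    0 < ∫ x in Set.Ioi (1:ℝ), (1 + x ^ (α / 2))⁻¹ := by
  rw [setIntegral_pos_iff_support_of_nonneg_ae]
  · have : Set.Ioi (1:ℝ) ⊆ (Function.support fun x : ℝ => (1 + x ^ (α / 2))⁻¹) ∩ Set.Ioi 1 := by
      intro x hx
      refine ⟨?_, hx⟩
      have hx0 : 0 < x := lt_trans one_pos hx
      have hp : 0 < x ^ (α/2) := Real.rpow_pos_of_pos hx0 _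
      simp only [Function.mem_support]
      positivity
    refine lt_of_lt_of_le ?_ (measure_mono this)
    simp
  · refine (ae_restrict_iff' measurableSet_Ioi).2 (Filter.Eventually.of_forall fun x hx => ?_)
    have hx0 : (0:ℝ) < x := lt_trans one_pos hx
    have hp : 0 < x ^ (α/2) := Real.rpow_pos_of_pos hx0 _
    simp only [Pi.zero_apply]
    positivity
  · exact aux_int α 1 hα one_pos

noncomputable def ff (α t : ℝ) : ℝ := (Real.exp t - 1) ^ (2 / α) *
        ∫ x in Set.Ioi ((Real.exp t - 1) ^ (-(2 / α))), (1 + x ^ (α / 2))⁻¹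

lemma ff_meas (α : ℝ) : Measurable (ff α) := by
  unfold ff
  refine Measurable.mul (by fun_prop) ?_
  have : (fun t : ℝ => ∫ x in Set.Ioi ((Real.exp t - 1) ^ (-(2 / α))), (1 + x ^ (α / 2))⁻¹)
      = fun t : ℝ => ∫ x : ℝ, {p : ℝ × ℝ | (Real.exp p.1 - 1) ^ (-(2 / α)) < p.2}.indicator
          (fun p => (1 + p.2 ^ (α / 2))⁻¹) (t, x) := by
    funext t
    rw [← integral_indicator measurableSet_Ioi]
    rfl
  rw [this]
  refine (StronglyMeasurable.integral_prod_right' (ν := volume) ?_).measurable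
  refine (Measurable.indicator (by fun_prop) ?_).stronglyMeasurable
  exact measurableSet_lt (by fun_prop) (by fun_prop)

lemma ff_nonneg (α t : ℝ) (ht : 0 < t) : 0 ≤ ff α t := by
  have h1 : 0 < Real.exp t - 1 := by linarith [Real.add_one_le_exp t]
  refine mul_nonneg (Real.rpow_nonneg h1.le _) (setIntegral_nonneg measurableSet_Ioi fun x hx => ?_)
  have hx0 : 0 < x := lt_trans (Real.rpow_pos_of_pos h1 _) hx
  have hp : 0 < x ^ (α/2) := Real.rpow_pos_of_pos hx0 _
  positivity

lemma ff_lb (α : ℝ) (hα : 2 < α) : ∃ c : ℝ, 0 < c ∧ ∀ t, Real.log 2 ≤ t →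
    c * (Real.exp (t/α))^2 ≤ ff α t := by
  have hc := aux_cpos α hα
  refine ⟨(1/2:ℝ)^(2/α) * ∫ x in Set.Ioi (1:ℝ), (1 + x ^ (α / 2))⁻¹, by positivity, ?_⟩
  intro t ht
  have h2 : 2 ≤ Real.exp t := by
    rwa [← Real.log_le_iff_le_exp (by norm_num)]
  have ha : 0 < α := by linarith
  have hpos : 0 < (Real.exp t - 1) ^ (-(2 / α)) := Real.rpow_pos_of_pos (by linarith) _
  have hle : (Real.exp t - 1) ^ (-(2 / α)) ≤ 1 :=
    Real.rpow_le_one_of_one_le_of_nonpos (by linarith) (by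
      have : 0 < 2/α := by positivity
      linarith)
  have hI : (∫ x in Set.Ioi (1:ℝ), (1 + x ^ (α / 2))⁻¹) ≤
      ∫ x in Set.Ioi ((Real.exp t - 1) ^ (-(2 / α))), (1 + x ^ (α / 2))⁻¹ := by
    refine setIntegral_mono_set (aux_int α _ hα hpos) ?_ (Set.Ioi_subset_Ioi hle).eventuallyLE
    refine (ae_restrict_iff' measurableSet_Ioi).2 (Filter.Eventually.of_forall fun x hx => ?_)
    have hx0 : (0:ℝ) < x := lt_trans hpos hx
    have hp : 0 < x ^ (α/2) := Real.rpow_pos_of_pos hx0 _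
    simp only [Pi.zero_apply]
    positivity
  have hE : (1/2:ℝ)^(2/α) * (Real.exp (t/α))^2 ≤ (Real.exp t - 1) ^ (2 / α) := by
    have : (Real.exp (t/α))^2 = (Real.exp t)^(2/α) := by
      rw [← Real.exp_mul, ← Real.exp_nat_mul]
      congr 1
      push_cast
      ring
    rw [this, ← Real.mul_rpow (by norm_num) (Real.exp_pos t).le]
    exact Real.rpow_le_rpow (by positivity) (by linarith) (by positivity)
  calc _ = ((1/2:ℝ)^(2/α) * (Real.exp (t/α))^2) * ∫ x in Set.Ioi (1:ℝ), (1 + x ^ (α / 2))⁻¹ := by ring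
    _ ≤ _ := mul_le_mul hE hI hc.le (Real.rpow_nonneg (by linarith) _)

lemma exp_bound (α A : ℝ) (hα : 2 < α) (hA : 0 < A) : ∃ K : ℝ, 0 < K ∧ ∀ s t : ℝ, 0 < s → 0 < t →
    Real.exp (-(A * s ^ 2) * ff α t) ≤ K * (1 + 1/s) * Real.exp (-(1/α) * t) := by
  obtain ⟨c, hc, hcf⟩ := ff_lb α hα
  have ha : 0 < α := by linarith
  refine ⟨2 + 1/√(A*c), by positivity, fun s t hs ht => ?_⟩
  have hs' : 0 < 1/s := by positivity
  have hk' : 0 < 1/√(A*c) := by positivity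
  rcases le_total t (Real.log 2) with h | h
  · have h1 : Real.exp (-(A * s ^ 2) * ff α t) ≤ 1 := by
      rw [Real.exp_le_one_iff]
      have := mul_nonneg (by positivity : 0 ≤ A*s^2) (ff_nonneg α t ht)
      linarith
    have h2 : 1/2 ≤ Real.exp (-(1/α) * t) := by
      have : (1/2:ℝ) = Real.exp (-Real.log 2) := by
        rw [Real.exp_neg, Real.exp_log (by norm_num)]; norm_num
      rw [this, Real.exp_le_exp]
      have : 1/α * t ≤ 1 * t := by
        gcongr
        rw [div_le_one ha]; linarith
      linarith
    have h3 : 2 ≤ (2 + 1/√(A*c)) * (1 + 1/s) := by nlinarith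
    nlinarith
  · have hb := hcf t h
    set E := Real.exp (t/α) with hE
    have hEp : 0 < E := Real.exp_pos _
    set y := √(A*c) * s * E with hy
    have hyp : 0 < y := by positivity
    have hy2 : y^2 ≤ A * s^2 * ff α t := by
      have : y^2 = A * s^2 * (c * E^2) := by
        rw [hy, mul_pow, mul_pow, Real.sq_sqrt (by positivity)]; ring
      rw [this]
      gcongr
    have h1 : Real.exp (-(A * s ^ 2) * ff α t) ≤ 1 / y := by
      rw [show -(A * s ^ 2) * ff α t = -(A * s ^ 2 * ff α t) by ring, Real.exp_neg, ← one_div]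
      apply one_div_le_one_div_of_le hyp
      have := Real.add_one_le_exp (A * s ^ 2 * ff α t)
      nlinarith [sq_nonneg (y-1)]
    have h2 : 1/y = 1/√(A*c) * (1/s) * Real.exp (-(1/α) * t) := by
      have : Real.exp (-(1/α) * t) = 1/E := by
        rw [hE, one_div, one_div, ← Real.exp_neg]; congr 1; ring
      rw [this, hy]
      field_simp
    rw [h2] at h1
    refine h1.trans ?_
    gcongr <;> linarith

noncomputable def HH (α lam μ σ2 b s t : ℝ) : ℝ :=
  Real.exp (-(π * lam * (b * s) ^ 2)) * Real.exp (-(σ2 * μ * (b * s) ^ α * (Real.exp t - 1))) *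
    Real.exp (-(π * lam * s ^ 2) * ff α t)

lemma HH_meas (α lam μ σ2 b : ℝ) : Measurable (fun p : ℝ × ℝ => HH α lam μ σ2 b p.1 p.2) := by
  have := ff_meas α
  unfold HH
  fun_prop

lemma HH_bound (α lam μ σ2 : ℝ) (hα : 2 < α) (hlam : 0 < lam) (hμ : 0 < μ) (hσ2 : 0 ≤ σ2) :
    ∃ K : ℝ, 0 < K ∧ ∀ b s t : ℝ, 0 < b → 0 < s → 0 < t →
      HH α lam μ σ2 b s t ≤
        Real.exp (-(π * lam * (b * s) ^ 2)) * (K * (1 + 1/s) * Real.exp (-(1/α) * t)) := by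
  obtain ⟨K, hK, h⟩ := exp_bound α (π * lam) hα (by positivity)
  refine ⟨K, hK, fun b s t hb hs ht => ?_⟩
  have h1 := h s t hs ht
  have h2 : Real.exp (-(σ2 * μ * (b * s) ^ α * (Real.exp t - 1))) ≤ 1 := by
    rw [Real.exp_le_one_iff]
    have h3 : 0 ≤ Real.exp t - 1 := by linarith [Real.add_one_le_exp t]
    have : 0 ≤ σ2 * μ * (b * s) ^ α * (Real.exp t - 1) := by positivity
    linarith
  unfold HH
  rw [mul_assoc]
  refine mul_le_mul_of_nonneg_left ?_ (Real.exp_pos _).le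
  calc _ ≤ 1 * Real.exp (-(π * lam * s ^ 2) * ff α t) := by gcongr
    _ ≤ _ := by rw [one_mul]; exact h1

lemma HH_nonneg (α lam μ σ2 b s t : ℝ) : 0 ≤ HH α lam μ σ2 b s t := by
  unfold HH; positivity

lemma exp_int (α : ℝ) (hα : 2 < α) :
    IntegrableOn (fun t : ℝ => Real.exp (-(1/α) * t)) (Set.Ioi 0) :=
  integrableOn_exp_mul_Ioi (by have : 0 < 1/α := by { have : 0 < α := by linarith
                                                      positivity }
                               linarith) 0

lemma HH_int (α lam μ σ2 : ℝ) (hα : 2 < α) (hlam : 0 < lam) (hμ : 0 < μ) (hσ2 : 0 ≤ σ2)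
    (b s : ℝ) (hb : 0 < b) (hs : 0 < s) :
    IntegrableOn (fun t => HH α lam μ σ2 b s t) (Set.Ioi 0) := by
  obtain ⟨K, hK, h⟩ := HH_bound α lam μ σ2 hα hlam hμ hσ2
  refine Integrable.mono' (((exp_int α hα).const_mul (K * (1 + 1/s))).const_mul
    (Real.exp (-(π * lam * (b * s) ^ 2)))) ?_ ?_
  · exact ((HH_meas α lam μ σ2 b).comp (measurable_prodMk_left (x := s))).aestronglyMeasurable
  · refine (ae_restrict_iff' measurableSet_Ioi).2 (Filter.Eventually.of_forall fun t ht => ?_)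
    rw [Real.norm_of_nonneg (HH_nonneg ..)]
    exact h b s t hb hs ht

lemma HH_int2 (α lam μ σ2 : ℝ) (hα : 2 < α) (hlam : 0 < lam) (hμ : 0 < μ) (hσ2 : 0 ≤ σ2)
    (b : ℝ) (hb : 0 < b) :
    IntegrableOn (fun s => (∫ t in Set.Ioi 0, HH α lam μ σ2 b s t) * (2 * π * lam * s))
      (Set.Ioi 0) := by
  obtain ⟨K, hK, h⟩ := HH_bound α lam μ σ2 hα hlam hμ hσ2
  set M := ∫ t in Set.Ioi (0:ℝ), Real.exp (-(1/α) * t) with hM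
  have hB : 0 < π * lam * b^2 := by positivity
  have i1 := (integrable_exp_neg_mul_sq hB).add (integrable_mul_exp_neg_mul_sq hB)
  have i2 := (i1.const_mul (K * M * (2 * π * lam))).integrableOn (s := Set.Ioi 0)
  refine Integrable.mono' i2 ?_ ?_
  · refine Measurable.aestronglyMeasurable (Measurable.mul ?_ (by fun_prop))
    exact (StronglyMeasurable.integral_prod_right' (ν := volume.restrict (Set.Ioi 0))
      (HH_meas α lam μ σ2 b).stronglyMeasurable).measurable
  · refine (ae_restrict_iff' measurableSet_Ioi).2 (Filter.Eventually.of_forall fun s hs => ?_)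
    have hs : 0 < s := hs
    have h0 : 0 ≤ ∫ t in Set.Ioi 0, HH α lam μ σ2 b s t :=
      integral_nonneg fun t => HH_nonneg ..
    rw [Real.norm_of_nonneg (by positivity)]
    have h1 : ∫ t in Set.Ioi 0, HH α lam μ σ2 b s t ≤
        Real.exp (-(π * lam * (b * s) ^ 2)) * (K * (1 + 1/s) * M) := by
      rw [hM, ← integral_const_mul, ← integral_const_mul]
      exact setIntegral_mono_on (HH_int α lam μ σ2 hα hlam hμ hσ2 b s hb hs)
        (((exp_int α hα).const_mul _).const_mul _) measurableSet_Ioi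
        fun t ht => h b s t hb hs ht
    calc _ ≤ Real.exp (-(π * lam * (b * s) ^ 2)) * (K * (1 + 1/s) * M) * (2 * π * lam * s) := by
          gcongr
      _ = _ := by
        simp only [Pi.add_apply]
        rw [show -(π * lam * (b * s) ^ 2) = -(π * lam * b^2) * s^2 by ring]
        field_simp
        ring

theorem stmt15 (α lam μ σ2 : ℝ) (hα : 2 < α) (hlam : 0 < lam) (hμ : 0 < μ) (hσ2 : 0 ≤ σ2)
    (f : ℝ → ℝ)
    (hf : ∀ t : ℝ, 0 < t →
      f t = (Real.exp t - 1) ^ (2 / α) *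
        ∫ x in Set.Ioi ((Real.exp t - 1) ^ (-(2 / α))), (1 + x ^ (α / 2))⁻¹)
    (τ : ℝ → ℝ)
    (hτ : ∀ δ : ℝ, 0 < δ →
      τ δ = (1 / δ) * ∫ r in Set.Ioi (0 : ℝ),
        (∫ t in Set.Ioi (0 : ℝ),
            Real.exp (-(π * lam * r ^ 2)) * Real.exp (-(σ2 * μ * r ^ α * (Real.exp t - 1))) *
              Real.exp (-(π * lam * r ^ 2 / δ) * f t)) * (2 * π * lam * r)) :
    ∀ δ₁ δ₂ : ℝ, 0 < δ₁ → δ₁ ≤ δ₂ → τ δ₂ ≤ τ δ₁ := by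
  have key : ∀ δ : ℝ, 0 < δ → τ δ = ∫ s in Set.Ioi (0:ℝ),
      (∫ t in Set.Ioi 0, HH α lam μ σ2 (√δ) s t) * (2 * π * lam * s) := by
    intro δ hδ
    have hb : 0 < √δ := Real.sqrt_pos.2 hδ
    have hbb : √δ ^ 2 = δ := Real.sq_sqrt hδ.le
    rw [hτ δ hδ]
    have hcv := integral_comp_mul_left_Ioi (fun r : ℝ => (∫ t in Set.Ioi (0 : ℝ),
            Real.exp (-(π * lam * r ^ 2)) * Real.exp (-(σ2 * μ * r ^ α * (Real.exp t - 1))) *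
              Real.exp (-(π * lam * r ^ 2 / δ) * f t)) * (2 * π * lam * r)) 0 hb
    rw [mul_zero, smul_eq_mul, eq_inv_mul_iff_mul_eq₀ hb.ne'] at hcv
    rw [← hcv, ← mul_assoc, ← integral_const_mul]
    refine setIntegral_congr_fun measurableSet_Ioi fun s hs => ?_
    have hin : (∫ t in Set.Ioi (0 : ℝ),
            Real.exp (-(π * lam * (√δ * s) ^ 2)) *
              Real.exp (-(σ2 * μ * (√δ * s) ^ α * (Real.exp t - 1))) *
              Real.exp (-(π * lam * (√δ * s) ^ 2 / δ) * f t))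
          = ∫ t in Set.Ioi 0, HH α lam μ σ2 (√δ) s t := by
      refine setIntegral_congr_fun measurableSet_Ioi fun t ht => ?_
      have e : f t = ff α t := hf t ht
      have e2 : π * lam * (√δ * s) ^ 2 / δ = π * lam * s ^ 2 := by
        rw [mul_pow, hbb]; field_simp
      simp only [HH, e, e2]
    simp only [hin]
    have e3 : 1 / δ * √δ * √δ = 1 := by
      rw [mul_assoc, ← sq, hbb]; field_simp
    linear_combination ((∫ t in Set.Ioi 0, HH α lam μ σ2 (√δ) s t) * (2 * π * lam * s)) * e3
  intro δ₁ δ₂ h1 h12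
  have h2 : 0 < δ₂ := lt_of_lt_of_le h1 h12
  have hb1 : 0 < √δ₁ := Real.sqrt_pos.2 h1
  have hb2 : 0 < √δ₂ := Real.sqrt_pos.2 h2
  have hb12 : √δ₁ ≤ √δ₂ := Real.sqrt_le_sqrt h12
  rw [key δ₁ h1, key δ₂ h2]
  refine setIntegral_mono_on (HH_int2 α lam μ σ2 hα hlam hμ hσ2 _ hb2)
    (HH_int2 α lam μ σ2 hα hlam hμ hσ2 _ hb1) measurableSet_Ioi fun s hs => ?_
  have hs : 0 < s := hs
  refine mul_le_mul_of_nonneg_right ?_ (by positivity)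
  refine setIntegral_mono_on (HH_int α lam μ σ2 hα hlam hμ hσ2 _ s hb2 hs)
    (HH_int α lam μ σ2 hα hlam hμ hσ2 _ s hb1 hs) measurableSet_Ioi fun t ht => ?_
  have ht : 0 < t := ht
  have h3 : 0 ≤ Real.exp t - 1 := by linarith [Real.add_one_le_exp t]
  have hα0 : 0 ≤ α := by linarith
  unfold HH
  gcongr
end
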